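/- arXiv:2001.03832 — 2 statements merged into one kernel-verified Lean document; each statement's English description precedes it below -/
import Mathlib

section
/- (Cyclic sum formula for multiple zeta-star values, Ohno–Wakabayashi.) Let k be a positive integer and let 𝐤=(k₁,…,k_r) be a nonempty index with k₁+⋯+k_r = k. Then Σ_{i=1}^r Σ_{j=0}^{k_i−2} ζ⋆(j+1, k_{i+1},…,k_r, k₁,…,k_{i−1}, k_i−j) = k·ζ(k+1) − δ_{𝐤,(1,…,1)}·k·ζ(k+1), where δ_{𝐤,(1,…,1)} equals 1 if all entries k₁=…=k_r=1 and 0 otherwise. (Each index appearing on the left has last entry k_i−j ≥ 2, so all the series involved converge; when all k_i = 1 both sides are 0.) -/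
/-- The multiple zeta-star value
`ζ⋆(k₁,…,k_r) = Σ_{1 ≤ n₁ ≤ ⋯ ≤ n_r} 1/(n₁^{k₁}⋯n_r^{k_r})`. -/
noncomputable def zetaStar (K : List ℕ) : ℝ :=
  ∑' n : {f : Fin K.length → ℕ+ // Monotone f},
    ∏ i, (1 : ℝ) / ((n.1 i : ℕ) : ℝ) ^ (K.get i)

/-- The Riemann zeta value `ζ(k) = Σ_{n ≥ 1} n^{−k}`. -/
noncomputable def zetaVal (k : ℕ) : ℝ := ∑' n : ℕ+, (1 : ℝ) / ((n : ℕ) : ℝ) ^ k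

namespace CSF

open scoped ENNReal
open Finset

/-- reciprocal of `n+1` -/
noncomputable def x (n : ℕ) : ℝ≥0∞ := ((n : ℝ≥0∞) + 1)⁻¹

/-- the kernel `1/(n-m)` for `m < n` -/
noncomputable def c (m n : ℕ) : ℝ≥0∞ := if m < n then (((n - m : ℕ) : ℝ≥0∞))⁻¹ else 0

/-- nested sums over chains `a ≤ n₁ ≤ ⋯ ≤ n_r` with weight `f n_r` -/
noncomputable def chain : List ℕ → ℕ → (ℕ → ℝ≥0∞) → ℝ≥0∞
  | [], a, f => f a
  | k :: L, a, f => ∑' n : ℕ, if a ≤ n then x n ^ k * chain L n f else 0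

lemma chain_congr (L : List ℕ) : ∀ (a : ℕ) (f g : ℕ → ℝ≥0∞), (∀ n, a ≤ n → f n = g n) →
    chain L a f = chain L a g := by
  induction L with
  | nil => intro a f g h; exact h a le_rfl
  | cons k L ih =>
    intro a f g h
    simp only [chain]
    refine tsum_congr fun n => ?_
    split_ifs with hn
    · rw [ih n f g fun b hb => h b (hn.trans hb)]
    · rfl

lemma chain_tsum {ι : Type*} (L : List ℕ) : ∀ (a : ℕ) (f : ι → ℕ → ℝ≥0∞),
    chain L a (fun n => ∑' i, f i n) = ∑' i, chain L a (f i) := by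
  induction L with
  | nil => intro a f; rfl
  | cons k L ih =>
    intro a f
    simp only [chain]
    rw [ENNReal.tsum_comm]
    refine tsum_congr fun n => ?_
    split_ifs with hn
    · rw [ih, ENNReal.tsum_mul_left]
    · simp

lemma chain_add (L : List ℕ) : ∀ (a : ℕ) (f g : ℕ → ℝ≥0∞),
    chain L a (fun n => f n + g n) = chain L a f + chain L a g := by
  induction L with
  | nil => intro a f g; rfl
  | cons k L ih =>
    intro a f g
    simp only [chain]
    rw [← ENNReal.tsum_add]
    refine tsum_congr fun n => ?_
    split_ifs with hn
    · rw [ih, mul_add]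
    · simp

lemma chain_mul (L : List ℕ) : ∀ (a : ℕ) (r : ℝ≥0∞) (f : ℕ → ℝ≥0∞),
    chain L a (fun n => r * f n) = r * chain L a f := by
  induction L with
  | nil => intro a r f; rfl
  | cons k L ih =>
    intro a r f
    simp only [chain]
    rw [← ENNReal.tsum_mul_left]
    refine tsum_congr fun n => ?_
    split_ifs with hn
    · rw [ih]; ring
    · simp

lemma chain_zero (L : List ℕ) (a : ℕ) : chain L a (fun _ => 0) = 0 := by
  have := chain_mul L a 0 (fun _ => 0)
  simpa using this

lemma chain_sum {ι : Type*} (s : Finset ι) (L : List ℕ) (a : ℕ) (f : ι → ℕ → ℝ≥0∞) :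
    chain L a (fun n => ∑ i ∈ s, f i n) = ∑ i ∈ s, chain L a (f i) := by
  classical
  induction s using Finset.induction_on with
  | empty => simpa using chain_zero L a
  | insert i s hi ih =>
    simp only [Finset.sum_insert hi]
    rw [chain_add, ih]

lemma chain_append (L : List ℕ) (k : ℕ) : ∀ (a : ℕ) (f : ℕ → ℝ≥0∞),
    chain (L ++ [k]) a f = chain L a (fun b => ∑' n : ℕ, if b ≤ n then x n ^ k * f n else 0) := by
  induction L with
  | nil => intro a f; rfl
  | cons k L ih =>
    intro a f
    simp only [chain, List.cons_append]
    refine tsum_congr fun n => ?_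
    rw [ih]

lemma chain_diag (L : List ℕ) (m : ℕ) (g : ℝ≥0∞) :
    chain L m (fun a => if a = m then g else 0) = x m ^ L.sum * g := by
  induction L with
  | nil => simp [chain]
  | cons k L ih =>
    simp only [chain]
    rw [tsum_eq_single m]
    · rw [if_pos le_rfl, ih, List.sum_cons, pow_add, mul_assoc]
    · intro b hb
      split_ifs with h
      · rw [chain_congr L b _ (fun _ => 0), chain_zero, mul_zero]
        intro n hn
        rw [if_neg]; omega
      · rfl

lemma x_ne_top (n : ℕ) : x n ≠ ∞ := by simp [x]
lemma x_ne_zero (n : ℕ) : x n ≠ 0 := by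
  simp [x]

/-- the auxiliary sums T -/
noncomputable def T (K : List ℕ) : ℝ≥0∞ := ∑' m, chain K m (c m)

/-- the zeta value -/
noncomputable def Z (k : ℕ) : ℝ≥0∞ := ∑' m, x m ^ k

lemma telescope (g d : ℕ → ℝ≥0∞) (h : ∀ n, g n = d n + g (n + 1))
    (h0 : Filter.Tendsto g Filter.atTop (nhds 0)) : ∑' n, d n = g 0 := by
  have key : ∀ N, ∑ n ∈ range N, d n + g N = g 0 := by
    intro N
    induction N with
    | zero => simp
    | succ N ih => rw [sum_range_succ, add_assoc, ← h, ih]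
  have h1 := (ENNReal.tendsto_nat_tsum d).add h0
  simp only [key, add_zero] at h1
  exact (tendsto_nhds_unique h1 tendsto_const_nhds)

lemma x_eq (n : ℕ) : x n = ENNReal.ofReal (1 / ((n : ℝ) + 1)) := by
  rw [x, one_div, ENNReal.ofReal_inv_of_pos (by positivity),
    ENNReal.ofReal_add (by positivity) (by positivity)]
  simp

lemma c_eq {m n : ℕ} (h : m < n) : c m n = ENNReal.ofReal (1 / ((n : ℝ) - m)) := by
  have : (0:ℝ) < (n:ℝ) - m := by
    rw [sub_pos]; exact_mod_cast h
  rw [c, if_pos h, one_div, ENNReal.ofReal_inv_of_pos this, ← Nat.cast_sub h.le,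
    ENNReal.ofReal_natCast]

lemma c_eq_x {m n : ℕ} (h : m < n) : c m n = x (n - m - 1) := by
  rw [c, if_pos h, x]
  congr 1
  have : n - m = (n - m - 1) + 1 := by omega
  rw [this]; simp

/-- partial fractions -/
lemma pf1 {m n : ℕ} (h : m < n) : x m * c m n = x n * c m n + x m * x n := by
  have : (0:ℝ) < (n:ℝ) - m := by
    rw [sub_pos]; exact_mod_cast h
  have h2 : (0:ℝ) < (n:ℝ) + 1 := by positivity
  have h3 : (0:ℝ) < (m:ℝ) + 1 := by positivity
  rw [c_eq h, x_eq, x_eq, ← ENNReal.ofReal_mul (by positivity), ← ENNReal.ofReal_mul (by positivity),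
    ← ENNReal.ofReal_mul (by positivity), ← ENNReal.ofReal_add (by positivity) (by positivity)]
  congr 1
  field_simp
  ring

lemma pf2 {m n : ℕ} (h : m < n) (p : ℕ) : x n * x m ^ p * c m n =
    x n ^ (p + 1) * c m n + ∑ j ∈ range p, x m ^ (j + 1) * x n ^ (p + 1 - j) := by
  induction p with
  | zero => simp
  | succ p ih =>
    have e : x n * x m ^ (p + 1) * c m n = x n * (x n * x m ^ p * c m n) + x m ^ (p + 1) * x n ^ 2 := by
      calc _ = x n * x m ^ p * (x m * c m n) := by ring
        _ = _ := by rw [pf1 h]; ring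
    rw [e, ih, mul_add, sum_range_succ, mul_sum]
    have : p + 1 + 1 - p = 2 := by omega
    rw [this]
    have : ∀ j ∈ range p, x n * (x m ^ (j + 1) * x n ^ (p + 1 - j)) =
        x m ^ (j + 1) * x n ^ (p + 1 + 1 - j) := by
      intro j hj
      have hj := mem_range.1 hj
      rw [show p + 1 + 1 - j = (p + 1 - j) + 1 by omega]
      ring
    rw [sum_congr rfl this]
    ring

/-- the inner sum -/
lemma pf3 {m n : ℕ} (h : m ≤ n) (p : ℕ) : x n * (x m ^ p * c m n)
    + (if n = m then (p : ℝ≥0∞) * x m ^ (p + 2) else 0) =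
    x n ^ (p + 1) * c m n + ∑ j ∈ range p, x m ^ (j + 1) * x n ^ (p + 1 - j) := by
  rcases h.lt_or_eq with h | h
  · rw [if_neg (by omega), add_zero, ← pf2 h, mul_assoc]
  · subst h
    have : ∀ j ∈ range p, x m ^ (j + 1) * x m ^ (p + 1 - j) = x m ^ (p + 2) := by
      intro j hj
      have hj := mem_range.1 hj
      rw [← pow_add]; congr 1; omega
    rw [sum_congr rfl this]
    simp [c]

lemma c_tendsto (l : ℕ) (a : ℕ) : Filter.Tendsto (fun i => c l (a + i)) Filter.atTop (nhds 0) := by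
  have h1 : Filter.Tendsto (fun i : ℕ => ((i : ℝ≥0∞))⁻¹) Filter.atTop (nhds 0) :=
    ENNReal.tendsto_inv_nat_nhds_zero
  have h2 : Filter.Tendsto (fun i : ℕ => a + i - l) Filter.atTop Filter.atTop := by
    apply Filter.tendsto_atTop.2
    intro b
    filter_upwards [Filter.eventually_ge_atTop (b + l)] with i hi
    omega
  refine tendsto_of_tendsto_of_tendsto_of_le_of_le tendsto_const_nhds (h1.comp h2)
    (fun _ => zero_le) (fun i => ?_)
  simp only [c, Function.comp]
  split_ifs
  · exact le_rfl
  · exact zero_le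

lemma tsum_ge (a : ℕ) (f : ℕ → ℝ≥0∞) : (∑' n, if a ≤ n then f n else 0) = ∑' i, f (a + i) := by
  have := Summable.sum_add_tsum_nat_add' (k := a) (f := fun n => if a ≤ n then f n else 0) ENNReal.summable
  rw [← this, sum_eq_zero, zero_add]
  · refine tsum_congr fun i => ?_
    rw [if_pos (by omega), add_comm]
  · intro i hi
    have := mem_range.1 hi
    rw [if_neg (by omega)]

/-- one step of the telescoping -/
lemma tel_step {m n : ℕ} (h : m < n) : x m * ∑ l ∈ range (m + 1), c l n =
    x n * c m n + x m * ∑ l ∈ range (m + 1), c l (n + 1) := by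
  have e : c m n + ∑ l ∈ range m, c l n = c m n + ∑ l ∈ range m, c (l + 1) (n + 1) := by
    congr 1
    refine sum_congr rfl fun l hl => ?_
    simp [c]
  rw [sum_range_succ, add_comm, e, mul_add, pf1 h, sum_range_succ', mul_add]
  have : c 0 (n + 1) = x n := by simp [c, x]
  rw [this]; ring

lemma tel_gt {m a : ℕ} (h : m < a) : (∑' n, if a ≤ n then x n * c m n else 0) =
    x m * ∑ l ∈ range (m + 1), c l a := by
  rw [tsum_ge, telescope (fun i => x m * ∑ l ∈ range (m + 1), c l (a + i))]
  · simp
  · intro n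
    exact tel_step (by omega)
  · have : Filter.Tendsto (fun i => ∑ l ∈ range (m + 1), c l (a + i)) Filter.atTop
        (nhds (∑ l ∈ range (m + 1), 0)) := tendsto_finsetSum _ fun l _ => c_tendsto l a
    have := ENNReal.Tendsto.const_mul (a := x m) this (Or.inr (x_ne_top m))
    simpa using this

lemma tel {m a : ℕ} (h : m ≤ a) : (∑' n, if a ≤ n then x n * c m n else 0) =
    x m * (∑ l ∈ range (m + 1), c l a) + if a = m then x m ^ 2 else 0 := by
  rcases h.lt_or_eq with h | h
  · rw [tel_gt h, if_neg (by omega), add_zero]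
  · subst h
    have e : (∑' n, if m ≤ n then x n * c m n else 0) =
        ∑' n, if m + 1 ≤ n then x n * c m n else 0 := by
      refine tsum_congr fun n => ?_
      by_cases h1 : m + 1 ≤ n
      · rw [if_pos h1, if_pos (by omega)]
      · rw [if_neg h1]
        have : c m n = 0 := by rw [c, if_neg (by omega)]
        simp [this]
    rw [e, tel_gt (Nat.lt_succ_self m), sum_range_succ', sum_range_succ _ m]
    have e2 : ∑ l ∈ range m, c (l + 1) (m + 1) = ∑ l ∈ range m, c l m :=
      sum_congr rfl fun l _ => by simp [c]
    have e3 : c 0 (m + 1) = x m := by simp [c, x]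
    have e4 : c m m = 0 := by simp [c]
    rw [e2, e3, e4, if_pos rfl]; ring

/-- the auxiliary sums U -/
noncomputable def U (p : ℕ) (L : List ℕ) : ℝ≥0∞ :=
  ∑' m, x m ^ p * chain L m (fun a => ∑' n, if a ≤ n then x n * c m n else 0)

lemma U_eq_T (p : ℕ) (L : List ℕ) : U p L = T ((p + 1) :: L) + Z (p + 1 + L.sum + 1) := by
  have hT : T ((p + 1) :: L) = ∑' m, x m ^ (p + 1) *
      chain L m (fun a => ∑ l ∈ range (m + 1), c l a) := by
    simp only [T, chain]
    rw [ENNReal.tsum_comm]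
    refine tsum_congr fun m => ?_
    rw [chain_sum, mul_sum, tsum_eq_sum (s := range (m + 1))]
    · refine sum_congr rfl fun l hl => ?_
      have := mem_range.1 hl
      rw [if_pos (by omega)]
    · intro l hl
      rw [mem_range] at hl
      rw [if_neg (by omega)]
  rw [hT, U, Z, ← ENNReal.tsum_add]
  refine tsum_congr fun m => ?_
  rw [chain_congr L m _ _ fun n hn => tel hn, chain_add, chain_mul, chain_diag]
  ring

lemma U_eq_sum (p : ℕ) (L : List ℕ) : U p L + p * Z (p + 1 + L.sum + 1) =
    T (L ++ [p + 1]) + ∑ j ∈ range p, chain ((j + 1) :: L ++ [p + 1 - j]) 0 (fun _ => 1) := by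
  have h1 : ∀ j, chain ((j + 1) :: L ++ [p + 1 - j]) 0 (fun _ => 1) =
      ∑' m, chain L m (fun a => ∑' n, if a ≤ n then x m ^ (j + 1) * x n ^ (p + 1 - j) else 0) := by
    intro j
    rw [List.cons_append]
    simp only [chain, zero_le, if_true]
    refine tsum_congr fun m => ?_
    rw [chain_append, ← chain_mul]
    refine chain_congr _ _ _ _ fun a _ => ?_
    rw [← ENNReal.tsum_mul_left]
    refine tsum_congr fun n => ?_
    split_ifs <;> simp
  simp only [h1]
  rw [← Summable.tsum_finsetSum (fun _ _ => ENNReal.summable), U, Z, T, ← ENNReal.tsum_mul_left,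
    ← ENNReal.tsum_add, ← ENNReal.tsum_add]
  refine tsum_congr fun m => ?_
  rw [chain_append, ← chain_sum, ← chain_add, ← chain_mul]
  have h2 : (p : ℝ≥0∞) * x m ^ (p + 1 + L.sum + 1) =
      chain L m (fun a => if a = m then (p : ℝ≥0∞) * x m ^ (p + 2) else 0) := by
    rw [chain_diag]; ring
  rw [h2, ← chain_add]
  refine chain_congr _ _ _ _ fun a ha => ?_
  have h3 : (if a = m then (p : ℝ≥0∞) * x m ^ (p + 2) else 0) =
      ∑' n, if a ≤ n then (if n = m then (p : ℝ≥0∞) * x m ^ (p + 2) else 0) else 0 := by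
    rw [tsum_eq_single m]
    · by_cases h : a = m
      · simp [h]
      · rw [if_neg h, if_neg (by omega)]
    · intro n hn
      simp [hn]
  rw [h3, ← ENNReal.tsum_mul_left, ← ENNReal.tsum_add,
    ← Summable.tsum_finsetSum (fun _ _ => ENNReal.summable), ← ENNReal.tsum_add]
  refine tsum_congr fun n => ?_
  by_cases h : a ≤ n
  · simp only [if_pos h]
    rw [← pf3 (ha.trans h)]; ring
  · simp [h]

/-- harmonic numbers -/
noncomputable def H (n : ℕ) : ℝ≥0∞ := ∑ i ∈ range (n + 1), x i

lemma sum_c (n : ℕ) : ∑' m, c m n ≤ H n := by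
  rw [tsum_eq_sum (s := range n), H, sum_range_succ, ← sum_range_reflect]
  · refine le_add_of_le_of_nonneg (le_of_eq (sum_congr rfl fun m hm => ?_)) zero_le
    have := mem_range.1 hm
    rw [c_eq_x (by omega)]
    congr 1; omega
  · intro m hm
    rw [mem_range] at hm
    rw [c, if_neg hm]

lemma x_le_one (n : ℕ) : x n ≤ 1 := by
  simp [x]

lemma chain_le_H (L : List ℕ) (hL : ∀ k ∈ L, 0 < k) (n : ℕ) : ∀ m,
    chain L m (fun a => if a ≤ n then 1 else 0) ≤ if m ≤ n then H n ^ L.length else 0 := by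
  induction L with
  | nil => intro m; simp [chain]
  | cons k L ih =>
    intro m
    have hk : 0 < k := hL k (by simp)
    have ih := ih fun k hk => hL k (by simp [hk])
    simp only [chain]
    have h1 : ∀ b, (if m ≤ b then x b ^ k * chain L b (fun a => if a ≤ n then 1 else 0) else 0) ≤
        if m ≤ n then (if b ∈ range (n + 1) then x b * H n ^ L.length else 0) else 0 := by
      intro b
      by_cases hb : m ≤ b
      · rw [if_pos hb]
        by_cases hbn : b ≤ n
        · rw [if_pos (hb.trans hbn), if_pos (mem_range.2 (by omega))]
          have := ih b
          rw [if_pos hbn] at this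
          refine mul_le_mul' ?_ this
          exact pow_le_of_le_one zero_le (x_le_one b) hk.ne'
        · have := ih b
          rw [if_neg hbn] at this
          rw [le_zero_iff.1 this]; simp
      · rw [if_neg hb]; exact zero_le
    refine (ENNReal.tsum_le_tsum h1).trans ?_
    by_cases hmn : m ≤ n
    · simp only [if_pos hmn]
      rw [tsum_eq_sum (s := range (n + 1))]
      · rw [sum_congr rfl fun b hb => if_pos hb, ← sum_mul, List.length_cons, pow_succ', H]
      · intro b hb; rw [if_neg hb]
    · simp [hmn]

lemma H_eq (n : ℕ) : H n = ENNReal.ofReal (∑ i ∈ range (n + 1), 1 / ((i : ℝ) + 1)) := by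
  rw [H, ENNReal.ofReal_sum_of_nonneg fun i _ => by positivity]
  exact sum_congr rfl fun i _ => x_eq i

lemma sum_H (p : ℕ) : ∑' n, x n ^ 2 * H n ^ p ≠ ∞ := by
  set ε : ℝ := 1 / (2 * (p + 1)) with hε
  have hε0 : 0 < ε := by positivity
  have hb : ∀ n : ℕ, x n ^ 2 * H n ^ p ≤
      ENNReal.ofReal ((1 + 1 / ε) ^ p * (1 / ((n + 1 : ℕ) : ℝ) ^ (3 / 2 : ℝ))) := by
    intro n
    rw [H_eq, x_eq, ← ENNReal.ofReal_pow (by positivity), ← ENNReal.ofReal_pow (by positivity),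
      ← ENNReal.ofReal_mul (by positivity)]
    apply ENNReal.ofReal_le_ofReal
    have h1 := harmonic_le_one_add_log (n + 1)
    have h2 : ((harmonic (n + 1) : ℚ) : ℝ) = ∑ i ∈ range (n + 1), 1 / ((i : ℝ) + 1) := by
      simp [harmonic]
    rw [h2] at h1
    set y : ℝ := ((n + 1 : ℕ) : ℝ) with hy
    have hy1 : 1 ≤ y := by rw [hy]; push_cast; linarith [Nat.cast_nonneg (α := ℝ) n]
    have hy0 : 0 < y := by linarith
    have h3 := Real.log_le_rpow_div hy0.le hε0
    have h4 : 1 ≤ y ^ ε := Real.one_le_rpow hy1 hε0.le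
    have h5 : ∑ i ∈ range (n + 1), 1 / ((i : ℝ) + 1) ≤ (1 + 1 / ε) * y ^ ε := by
      calc _ ≤ _ := h1
        _ ≤ y ^ ε + y ^ ε / ε := add_le_add h4 h3
        _ = _ := by ring
    have h6 : (∑ i ∈ range (n + 1), 1 / ((i : ℝ) + 1)) ^ p ≤ (1 + 1 / ε) ^ p * y ^ (1 / 2 : ℝ) := by
      calc _ ≤ ((1 + 1 / ε) * y ^ ε) ^ p := pow_le_pow_left₀ (by positivity) h5 p
        _ = (1 + 1 / ε) ^ p * y ^ (ε * p) := by
            rw [mul_pow, Real.rpow_mul hy0.le, Real.rpow_natCast]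
        _ ≤ _ := by
            refine mul_le_mul_of_nonneg_left (Real.rpow_le_rpow_of_exponent_le hy1 ?_) (by positivity)
            rw [hε, div_mul_eq_mul_div, one_mul, div_le_div_iff₀ (by positivity) (by positivity)]
            linarith
    have h7 : (1 / ((n : ℝ) + 1)) ^ 2 = 1 / y ^ 2 := by rw [hy]; push_cast; simp
    rw [h7]
    calc _ ≤ 1 / y ^ 2 * ((1 + 1 / ε) ^ p * y ^ (1 / 2 : ℝ)) :=
          mul_le_mul_of_nonneg_left h6 (by positivity)
      _ = (1 + 1 / ε) ^ p * (1 / y ^ (3 / 2 : ℝ)) := by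
          have : y ^ 2 = y ^ (3 / 2 : ℝ) * y ^ (1 / 2 : ℝ) := by
            rw [← Real.rpow_add hy0, ← Real.rpow_natCast]; norm_num
          rw [this]
          have a1 : 0 < y ^ (3 / 2 : ℝ) := by positivity
          have a2 : 0 < y ^ (1 / 2 : ℝ) := by positivity
          field_simp
  refine ne_top_of_le_ne_top ?_ (ENNReal.tsum_le_tsum hb)
  have hs : Summable fun n : ℕ => (1 + 1 / ε) ^ p * (1 / ((n + 1 : ℕ) : ℝ) ^ (3 / 2 : ℝ)) := by
    apply Summable.mul_left
    exact (summable_nat_add_iff 1).2 (Real.summable_one_div_nat_rpow.2 (by norm_num))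
  rw [← ENNReal.ofReal_tsum_of_nonneg (fun n => by positivity) hs]
  exact ENNReal.ofReal_ne_top

lemma T_last (L : List ℕ) (hL : ∀ k ∈ L, 0 < k) (h : ℕ) (hh : 2 ≤ h) : T (L ++ [h]) ≠ ∞ := by
  refine ne_top_of_le_ne_top (sum_H (L.length + 1)) ?_
  have h1 : ∀ m, chain (L ++ [h]) m (c m) ≤ ∑' n, x n ^ 2 * c m n * H n ^ L.length := by
    intro m
    have e : chain (L ++ [h]) m (c m) =
        ∑' n, x n ^ h * c m n * chain L m (fun a => if a ≤ n then 1 else 0) := by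
      rw [chain_append, ← tsum_congr fun n => chain_mul L m (x n ^ h * c m n) _, ← chain_tsum]
      refine chain_congr _ _ _ _ fun a _ => tsum_congr fun n => ?_
      split_ifs <;> simp
    rw [e]
    refine ENNReal.tsum_le_tsum fun n => ?_
    refine mul_le_mul' (mul_le_mul' (pow_le_pow_of_le_one zero_le (x_le_one n) hh) le_rfl) ?_
    refine (chain_le_H L hL n m).trans ?_
    split_ifs
    · exact le_rfl
    · exact zero_le
  refine (ENNReal.tsum_le_tsum h1).trans ?_
  rw [ENNReal.tsum_comm]
  refine ENNReal.tsum_le_tsum fun n => ?_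
  have : ∀ m, x n ^ 2 * c m n * H n ^ L.length = (x n ^ 2 * H n ^ L.length) * c m n := by
    intro m; ring
  rw [tsum_congr this, ENNReal.tsum_mul_left, pow_succ (H n), ← mul_assoc]
  exact mul_le_mul' le_rfl (sum_c n)

lemma Z_ne_top (k : ℕ) (hk : 2 ≤ k) : Z k ≠ ∞ := by
  refine ne_top_of_le_ne_top (sum_H 0) (ENNReal.tsum_le_tsum fun n => ?_)
  rw [pow_zero, mul_one]
  exact pow_le_pow_of_le_one zero_le (x_le_one n) hk

lemma T_rot (h : ℕ) (hh : 0 < h) (L : List ℕ) (hT : T (h :: L) ≠ ∞) : T (L ++ [h]) ≠ ∞ := by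
  obtain ⟨p, rfl⟩ : ∃ p, h = p + 1 := ⟨h - 1, by omega⟩
  have hZ : Z (p + 1 + L.sum + 1) ≠ ∞ := Z_ne_top _ (by omega)
  have h1 := U_eq_sum p L
  rw [U_eq_T] at h1
  refine ne_top_of_le_ne_top ?_ (le_self_add.trans h1.symm.le)
  exact ENNReal.add_ne_top.2 ⟨ENNReal.add_ne_top.2 ⟨hT, hZ⟩,
    ENNReal.mul_ne_top (ENNReal.natCast_ne_top p) hZ⟩

lemma rot_cons (K : List ℕ) (hne : K ≠ []) (i : ℕ) : ∃ h L, K.rotate i = h :: L ∧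
    K.rotate (i + 1) = L ++ [h] := by
  have : K.rotate i ≠ [] := by simpa using hne
  obtain ⟨h, L, e⟩ := List.exists_cons_of_ne_nil this
  refine ⟨h, L, e, ?_⟩
  rw [← List.rotate_rotate, e]; simp

lemma T_fin (K : List ℕ) (hpos : ∀ n ∈ K, 0 < n) (hne : K ≠ []) (h1 : ¬ ∀ n ∈ K, n = 1) :
    ∀ i, T (K.rotate i) ≠ ∞ := by
  push Not at h1
  obtain ⟨h, hK, hh⟩ := h1
  have hh2 : 2 ≤ h := by have := hpos h hK; omega
  obtain ⟨A, B, rfl⟩ := List.append_of_mem hK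
  have hstep : ∀ i, T (((A ++ h :: B)).rotate i) ≠ ∞ →
      T (((A ++ h :: B)).rotate (i + 1)) ≠ ∞ := by
    intro i hi
    obtain ⟨g, L, e1, e2⟩ := rot_cons _ hne i
    rw [e2]
    rw [e1] at hi
    refine T_rot g (hpos g ?_) L hi
    rw [← List.mem_rotate (n := i), e1]; simp
  have h0 : T ((A ++ h :: B).rotate (A.length + 1)) ≠ ∞ := by
    have : (A ++ h :: B).rotate (A.length + 1) = (B ++ A) ++ [h] := by
      rw [← List.rotate_rotate, List.rotate_append_length_eq]; simp
    rw [this]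
    refine T_last _ (fun k hk => hpos k ?_) h hh2
    simp at hk ⊢; tauto
  have hup : ∀ j, T ((A ++ h :: B).rotate (A.length + 1 + j)) ≠ ∞ := by
    intro j
    induction j with
    | zero => exact h0
    | succ j ih => exact hstep _ ih
  intro i
  have : (A ++ h :: B).rotate i = (A ++ h :: B).rotate (A.length + 1 + (i + B.length)) := by
    rw [show A.length + 1 + (i + B.length) = (A ++ h :: B).length + i by simp; omega,
      ← List.rotate_rotate, List.rotate_length]
  rw [this]
  exact hup _

/-- conversion of the recursive chains into sums over monotone functions -/
lemma chain_eq (K : List ℕ) : ∀ a : ℕ, (∑' f : Fin K.length → ℕ+,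
    (open Classical in if Monotone f ∧ ∀ i, a + 1 ≤ (f i : ℕ) then
      ∏ i, (((f i : ℕ) : ℝ≥0∞)⁻¹) ^ (K.get i) else 0)) = chain K a (fun _ => 1) := by
  classical
  induction K with
  | nil =>
    intro a
    simp only [chain, List.length_nil]
    rw [tsum_eq_single default (fun b hb => (hb (Subsingleton.elim _ _)).elim), if_pos]
    · simp
    · exact ⟨Subsingleton.monotone _, fun i => i.elim0⟩
  | cons k L ih =>
    intro a
    simp only [chain, List.length_cons]
    rw [← (Fin.consEquiv (fun _ : Fin (L.length + 1) => ℕ+)).tsum_eq, ENNReal.tsum_prod',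
      ← Equiv.pnatEquivNat.symm.tsum_eq]
    refine tsum_congr fun n => ?_
    rw [← ih n]
    have hn : ((Equiv.pnatEquivNat.symm n : ℕ+) : ℕ) = n + 1 := rfl
    by_cases han : a ≤ n
    · rw [if_pos han, ← ENNReal.tsum_mul_left]
      refine tsum_congr fun f => ?_
      have hcons : (Fin.consEquiv (fun _ : Fin (L.length + 1) => ℕ+))
          (Equiv.pnatEquivNat.symm n, f) = Fin.cons (Equiv.pnatEquivNat.symm n) f := rfl
      rw [hcons]
      have hiff : (Monotone (Fin.cons (Equiv.pnatEquivNat.symm n) f : Fin (L.length + 1) → ℕ+) ∧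
          ∀ i, a + 1 ≤ ((Fin.cons (Equiv.pnatEquivNat.symm n) f : Fin (L.length + 1) → ℕ+) i : ℕ)) ↔
          (Monotone f ∧ ∀ i, n + 1 ≤ (f i : ℕ)) := by
        constructor
        · rintro ⟨h1, h2⟩
          refine ⟨fun i j hij => ?_, fun i => ?_⟩
          · have := h1 (Fin.succ_le_succ_iff.2 hij)
            simpa using this
          · have := h1 (Fin.zero_le i.succ)
            rw [Fin.cons_zero, Fin.cons_succ, ← PNat.coe_le_coe, hn] at this
            exact this
        · rintro ⟨h1, h2⟩
          refine ⟨fun i j hij => ?_, fun i => ?_⟩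
          · induction i using Fin.cases with
            | zero =>
              induction j using Fin.cases with
              | zero => exact le_rfl
              | succ j =>
                rw [Fin.cons_zero, Fin.cons_succ, ← PNat.coe_le_coe, hn]
                exact h2 j
            | succ i =>
              induction j using Fin.cases with
              | zero => exact absurd hij (by simp)
              | succ j =>
                rw [Fin.cons_succ, Fin.cons_succ]
                exact h1 (Fin.succ_le_succ_iff.1 hij)
          · induction i using Fin.cases with
            | zero => rw [Fin.cons_zero, hn]; omega
            | succ i => rw [Fin.cons_succ]; have := h2 i; omega
      by_cases hc : Monotone f ∧ ∀ i, n + 1 ≤ (f i : ℕ)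
      · rw [if_pos (hiff.2 hc), if_pos hc, Fin.prod_univ_succ]
        simp [x, hn]
      · rw [if_neg (fun h => hc (hiff.1 h)), if_neg hc, mul_zero]
    · rw [if_neg han]
      refine ENNReal.tsum_eq_zero.2 fun f => ?_
      rw [if_neg]
      rintro ⟨-, h⟩
      have := h 0
      simp only [Fin.consEquiv, Equiv.coe_fn_mk, Fin.cons_zero, hn] at this
      omega

lemma zetaStar_eq (K : List ℕ) : zetaStar K = (chain K 0 (fun _ => 1)).toReal := by
  classical
  rw [← chain_eq]
  have h0 : (∑' f : Fin K.length → ℕ+,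
    (open Classical in if Monotone f ∧ ∀ i, 0 + 1 ≤ (f i : ℕ) then
      ∏ i, (((f i : ℕ) : ℝ≥0∞)⁻¹) ^ (K.get i) else 0)) =
      ∑' f : {f : Fin K.length → ℕ+ // Monotone f}, ∏ i, (((f.1 i : ℕ) : ℝ≥0∞)⁻¹) ^ (K.get i) := by
    have := tsum_subtype {f : Fin K.length → ℕ+ | Monotone f}
      (fun f => ∏ i, (((f i : ℕ) : ℝ≥0∞)⁻¹) ^ (K.get i))
    refine Eq.trans ?_ this.symm
    refine tsum_congr fun f => ?_
    rw [Set.indicator_apply]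
    have : (Monotone f ∧ ∀ i, 0 + 1 ≤ (f i : ℕ)) ↔ f ∈ {f : Fin K.length → ℕ+ | Monotone f} :=
      ⟨fun h => h.1, fun h => ⟨h, fun i => by have := (f i).pos; omega⟩⟩
    simp only [this]
  rw [h0, ENNReal.tsum_toReal_eq, zetaStar]
  · refine tsum_congr fun f => ?_
    rw [ENNReal.toReal_prod]
    refine prod_congr rfl fun i _ => ?_
    simp
  · intro f
    refine ENNReal.prod_ne_top fun i _ => ENNReal.pow_ne_top ?_
    simp

lemma zetaVal_eq (k : ℕ) : zetaVal k = (Z k).toReal := by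
  rw [Z, ENNReal.tsum_toReal_eq, zetaVal, ← Equiv.pnatEquivNat.symm.tsum_eq]
  · refine tsum_congr fun n => ?_
    have hn : ((Equiv.pnatEquivNat.symm n : ℕ+) : ℕ) = n + 1 := rfl
    rw [hn, x_eq, ENNReal.toReal_pow, ENNReal.toReal_ofReal (by positivity)]
    push_cast
    simp
  · intro n; exact ENNReal.pow_ne_top (x_ne_top n)

lemma main (K : List ℕ) (hne : K ≠ []) (hpos : ∀ n ∈ K, 0 < n) (h1 : ¬ ∀ n ∈ K, n = 1) :
    (∑ i ∈ range K.length, ∑ j ∈ range ((K.rotate i).headI - 1),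
      chain (((j + 1) :: (K.rotate i).tail) ++ [(K.rotate i).headI - j]) 0 (fun _ => 1))
      = (K.sum : ℝ≥0∞) * Z (K.sum + 1) := by
  have hfin := T_fin K hpos hne h1
  have hi : ∀ i ∈ range K.length, T (K.rotate i) + ((K.rotate i).headI : ℝ≥0∞) * Z (K.sum + 1) =
      T (K.rotate (i + 1)) + ∑ j ∈ range ((K.rotate i).headI - 1),
      chain (((j + 1) :: (K.rotate i).tail) ++ [(K.rotate i).headI - j]) 0 (fun _ => 1) := by
    intro i _
    obtain ⟨h, L, e1, e2⟩ := rot_cons K hne i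
    have hh : 0 < h := hpos h (by rw [← List.mem_rotate (n := i), e1]; simp)
    obtain ⟨p, rfl⟩ : ∃ p, h = p + 1 := ⟨h - 1, by omega⟩
    have hs : K.sum = p + 1 + L.sum := by
      rw [← (List.rotate_perm K i).sum_eq, e1]; simp
    rw [e1, e2, hs]
    have := U_eq_sum p L
    rw [U_eq_T] at this
    simp only [List.headI, List.tail_cons, Nat.add_sub_cancel]
    rw [← this]
    push_cast
    ring
  have hsum := sum_congr rfl hi
  rw [sum_add_distrib, sum_add_distrib, ← sum_mul] at hsum
  have hT : ∑ i ∈ range K.length, T (K.rotate (i + 1)) = ∑ i ∈ range K.length, T (K.rotate i) := by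
    have a := sum_range_succ (fun i => T (K.rotate i)) K.length
    have b := sum_range_succ' (fun i => T (K.rotate i)) K.length
    rw [a] at b
    simp only [List.rotate_length, List.rotate_zero] at b
    have h0 : T K ≠ ∞ := by simpa using hfin 0
    exact ((ENNReal.add_left_inj h0).1 b).symm
  have hhead : ∑ i ∈ range K.length, ((K.rotate i).headI : ℝ≥0∞) = (K.sum : ℝ≥0∞) := by
    rw [← Nat.cast_sum]
    congr 1
    have : K.sum = ∑ i : Fin K.length, K.get i := by
      simp [← List.sum_ofFn]
    rw [this, Finset.sum_range]
    refine sum_congr rfl fun i _ => ?_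
    have h2 : (K.rotate i)[0]? = K[(i : ℕ)]? := by
      rw [List.getElem?_rotate (by have := i.2; omega)]
      congr 1
      rw [zero_add]
      exact Nat.mod_eq_of_lt i.2
    obtain ⟨h, L, e1, -⟩ := rot_cons K hne i
    rw [e1] at h2 ⊢
    simp at h2
    simpa using h2
  rw [hT, hhead] at hsum
  have hTfin : ∑ i ∈ range K.length, T (K.rotate i) ≠ ∞ :=
    ENNReal.sum_ne_top.2 fun i _ => hfin i
  exact ((ENNReal.add_right_inj hTfin).1 hsum).symm

end CSF

/-- **Cyclic sum formula for multiple zeta-star values** (Ohno–Wakabayashi).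
For a nonempty index `𝐤 = (k₁,…,k_r)` of weight `k`,
`Σ_{i=1}^r Σ_{j=0}^{k_i−2} ζ⋆(j+1, k_{i+1},…,k_r, k₁,…,k_{i−1}, k_i−j)
 = k·ζ(k+1) − δ_{𝐤,(1,…,1)}·k·ζ(k+1)`. -/
theorem cyclic_sum_formula_zetaStar (k : ℕ) (hk : 0 < k) (K : List ℕ) (hne : K ≠ [])
    (hpos : ∀ n ∈ K, 0 < n) (hw : K.sum = k) :
    (∑ i ∈ Finset.range K.length, ∑ j ∈ Finset.range ((K.rotate i).headI - 1),
        zetaStar (((j + 1) :: (K.rotate i).tail) ++ [(K.rotate i).headI - j]))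
      = (k : ℝ) * zetaVal (k + 1)
        - (if ∀ x ∈ K, x = 1 then (1 : ℝ) else 0) * ((k : ℝ) * zetaVal (k + 1)) := by
  subst hw
  by_cases h1 : ∀ n ∈ K, n = 1
  · rw [if_pos h1, one_mul, sub_self]
    refine Finset.sum_eq_zero fun i _ => ?_
    obtain ⟨h, L, e1, -⟩ := CSF.rot_cons K hne i
    have : h = 1 := h1 h (by rw [← List.mem_rotate (n := i), e1]; simp)
    rw [e1, this]; simp
  · rw [if_neg h1, zero_mul, sub_zero]
    have hm := CSF.main K hne hpos h1
    have hZ : (K.sum : ENNReal) * CSF.Z (K.sum + 1) ≠ ⊤ :=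
      ENNReal.mul_ne_top (ENNReal.natCast_ne_top _) (CSF.Z_ne_top _ (by omega))
    have hs := hm ▸ hZ
    rw [ENNReal.sum_ne_top] at hs
    have hr := congrArg ENNReal.toReal hm
    rw [ENNReal.toReal_sum hs, ENNReal.toReal_mul, ENNReal.toReal_natCast] at hr
    rw [CSF.zetaVal_eq, ← hr]
    refine Finset.sum_congr rfl fun i hi => ?_
    rw [ENNReal.toReal_sum (ENNReal.sum_ne_top.1 (hs i hi))]
    exact Finset.sum_congr rfl fun j _ => CSF.zetaStar_eq _
end

section
/- (Yamamoto's integral representation of multiple zeta-star values.) Let 𝐤=(k₁,…,k_r) be a nonempty index with k_r ≥ 2. Then the labeled poset X⋆(𝐤) is admissible (every maximal element has label x and every minimal element has label y), and ζ⋆(k₁,…,k_r) = I(X⋆(𝐤)). -/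
/-- The underlying set of the labeled poset `X⋆(𝐤)`: the disjoint union of the chains
`C_j = {c_{j,0} < ⋯ < c_{j,k_j−1}}`, `1 ≤ j ≤ r`. -/
def Carrier (K : List ℕ) : Type := (j : Fin K.length) × Fin (K.get j)

instance (K : List ℕ) : Fintype (Carrier K) :=
  inferInstanceAs (Fintype ((j : Fin K.length) × Fin (K.get j)))

instance (K : List ℕ) : DecidableEq (Carrier K) :=
  inferInstanceAs (DecidableEq ((j : Fin K.length) × Fin (K.get j)))

/-- The partial order of `X⋆(𝐤)`: the order generated by the chain relations together
with the relations `c_{j+1,k_{j+1}−1} > c_{j,0}` (written out explicitly: one can jump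
from the bottom of a chain to the top of a later chain provided all intermediate chains
are singletons). -/
def cle (K : List ℕ) (p q : (j : Fin K.length) × Fin (K.get j)) : Prop :=
  (p.1 = q.1 ∧ p.2.val ≤ q.2.val) ∨
    (p.1 < q.1 ∧ p.2.val = 0 ∧ q.2.val + 1 = K.get q.1 ∧
      ∀ m : Fin K.length, p.1 < m → m < q.1 → K.get m = 1)

theorem sigEq {K : List ℕ} (p q : (j : Fin K.length) × Fin (K.get j))
    (h1 : p.1 = q.1) (h2 : p.2.val = q.2.val) : p = q := by
  obtain ⟨j, a⟩ := p
  obtain ⟨j', b⟩ := q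
  have h1' : j = j' := h1
  subst h1'
  have h2' : a = b := Fin.ext h2
  rw [h2']

theorem cle_trans (K : List ℕ) (p q s : (j : Fin K.length) × Fin (K.get j))
    (h : cle K p q) (h' : cle K q s) : cle K p s := by
  rcases h with ⟨h1, h2⟩ | ⟨h1, h2, h3, h4⟩
  · rcases h' with ⟨g1, g2⟩ | ⟨g1, g2, g3, g4⟩
    · exact Or.inl ⟨h1.trans g1, h2.trans g2⟩
    · exact Or.inr ⟨h1.le.trans_lt g1, by omega,
        g3, fun m hm1 hm2 => g4 m (h1.symm.le.trans_lt hm1) hm2⟩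
  · rcases h' with ⟨g1, g2⟩ | ⟨g1, g2, g3, g4⟩
    · have hks : K.get q.1 = K.get s.1 := by rw [g1]
      have hlt : s.2.val < K.get s.1 := s.2.isLt
      exact Or.inr ⟨h1.trans_le g1.le, h2, by omega,
        fun m hm1 hm2 => h4 m hm1 (hm2.trans_le g1.symm.le)⟩
    · refine Or.inr ⟨h1.trans g1, h2, g3, fun m hm1 hm2 => ?_⟩
      rcases lt_trichotomy m q.1 with hc | hc | hc
      · exact h4 m hm1 hc
      · rw [hc]; omega
      · exact g4 m hc hm2

theorem cle_antisymm (K : List ℕ) (p q : (j : Fin K.length) × Fin (K.get j))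
    (h : cle K p q) (h' : cle K q p) : p = q := by
  rcases h with ⟨h1, h2⟩ | ⟨h1, h2, h3, h4⟩
  · rcases h' with ⟨g1, g2⟩ | ⟨g1, g2, g3, g4⟩
    · exact sigEq p q h1 (le_antisymm h2 g2)
    · rw [h1] at g1; exact absurd g1 (lt_irrefl _)
  · rcases h' with ⟨g1, g2⟩ | ⟨g1, g2, g3, g4⟩
    · rw [g1] at h1; exact absurd h1 (lt_irrefl _)
    · exact absurd (h1.trans g1) (lt_irrefl _)

instance (K : List ℕ) : PartialOrder (Carrier K) where
  le := cle K
  le_refl p := Or.inl ⟨rfl, le_refl _⟩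
  le_trans := cle_trans K
  le_antisymm := cle_antisymm K

/-- The label map of `X⋆(𝐤)`: the bottom element of each chain is labeled `y` (= `1`),
all other elements are labeled `x` (= `0`). -/
def lab (K : List ℕ) : Carrier K → Fin 2 := fun p => if p.2.val = 0 then 1 else 0

open MeasureTheory in
/-- Yamamoto's integral `I(X)` attached to a finite labeled poset `(X,δ)`:
`I(X) = ∫_{Δ_X} ∏_{p∈X} ω_{δ(p)}(t_p)` where `ω_x(t) = dt/t`, `ω_y(t) = dt/(1−t)` and
`Δ_X = {(t_p)_p ∈ (0,1)^X : t_p < t_q whenever p < q}`. -/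
noncomputable def Ifun (α : Type) [Fintype α] [PartialOrder α] (δ : α → Fin 2) : ℝ :=
  ∫ t : α → ℝ in
    {t | (∀ p, t p ∈ Set.Ioo (0 : ℝ) 1) ∧ ∀ p q : α, p < q → t p < t q},
    ∏ p, (if δ p = 0 then 1 / t p else 1 / (1 - t p))

open MeasureTheory ENNReal

open Classical in
/-- nested sum functional -/
noncomputable def WW : List ℕ → (WithTop ℕ+ → ℝ≥0∞) → ℝ≥0∞
  | [], φ => φ ⊤
  | k :: L, φ => WW L (fun N => ∑' m : ℕ+,
      if (m : WithTop ℕ+) ≤ N then ENNReal.ofReal (1 / ((m : ℕ) : ℝ) ^ k) * φ m else 0)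

theorem WW_mul (L : List ℕ) (c : ℝ≥0∞) : ∀ φ : WithTop ℕ+ → ℝ≥0∞,
    WW L (fun N => c * φ N) = c * WW L φ := by
  induction L with
  | nil => intro φ; rfl
  | cons k L ih =>
    intro φ
    simp only [WW]
    rw [← ih]
    congr 1
    funext N
    rw [← ENNReal.tsum_mul_left]
    congr 1
    funext m
    split_ifs
    · ring
    · simp

theorem WW_lintegral {α : Type} [MeasurableSpace α] (μ : Measure α) (L : List ℕ) :
    ∀ f : WithTop ℕ+ → α → ℝ≥0∞, (∀ N, Measurable (f N)) →
    Measurable (fun x => WW L (fun N => f N x)) ∧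
    WW L (fun N => ∫⁻ x, f N x ∂μ) = ∫⁻ x, WW L (fun N => f N x) ∂μ := by
  induction L with
  | nil => intro f hf; exact ⟨hf ⊤, rfl⟩
  | cons k L ih =>
    intro f hf
    classical
    have hm : ∀ N : WithTop ℕ+, ∀ m : ℕ+, Measurable (fun x =>
      if (m : WithTop ℕ+) ≤ N then ENNReal.ofReal (1 / ((m : ℕ) : ℝ) ^ k) * f m x else 0) := by
      intro N m
      split_ifs
      · exact (hf m).const_mul _
      · exact measurable_const
    have := ih (fun N x => ∑' m : ℕ+,
      if (m : WithTop ℕ+) ≤ N then ENNReal.ofReal (1 / ((m : ℕ) : ℝ) ^ k) * f m x else 0)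
      (fun N => Measurable.tsum (hm N))
    simp only [WW]
    refine ⟨?_, ?_⟩
    · convert this.1 using 6
    · refine Eq.trans ?_ (this.2.trans ?_)
      · congr 1
        funext N
        rw [lintegral_tsum (fun m => (hm N m).aemeasurable)]
        congr 1
        funext m
        split_ifs
        · rw [lintegral_const_mul _ (hf m)]
        · simp
      · congr 1

/-- first entry of a tuple, or infinity -/
noncomputable def hd {l : ℕ} (n : Fin l → ℕ+) : WithTop ℕ+ :=
  if h : 0 < l then ((n ⟨0, h⟩ : ℕ+) : WithTop ℕ+) else ⊤

theorem WW_eq (K : List ℕ) : ∀ φ : WithTop ℕ+ → ℝ≥0∞,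
    WW K φ = ∑' n : {f : Fin K.length → ℕ+ // Monotone f},
      (∏ i, ENNReal.ofReal ((1 : ℝ) / ((n.1 i : ℕ) : ℝ) ^ (K.get i))) * φ (hd n.1) := by
  induction K with
  | nil =>
    intro φ
    have : Unique {f : Fin ([] : List ℕ).length → ℕ+ // Monotone f} :=
      { default := ⟨fun i => i.elim0, fun i => i.elim0⟩
        uniq := fun f => Subtype.ext (funext fun i => i.elim0) }
    have h0 : (Finset.univ : Finset (Fin ([] : List ℕ).length)) = ∅ := rfl
    rw [tsum_eq_single default (fun b hb => absurd (Subsingleton.elim _ _) hb)]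
    simp [WW, hd]
  | cons k L ih =>
    intro φ
    classical
    simp only [WW]
    rw [ih]
    simp_rw [← ENNReal.tsum_mul_left]
    rw [← ENNReal.tsum_prod]
    let e : {f : Fin (k :: L).length → ℕ+ // Monotone f} →
        {f : Fin L.length → ℕ+ // Monotone f} × ℕ+ :=
      fun n => (⟨fun i => n.1 i.succ, fun i j h => n.2 (Fin.succ_le_succ_iff.2 h)⟩, n.1 ⟨0, by simp⟩)
    have he : Function.Injective e := by
      intro a b hab
      have h1 := congrArg (fun x => x.1.1) hab
      have h2 := congrArg (fun x => x.2) hab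
      apply Subtype.ext
      funext i
      refine Fin.cases ?_ (fun j => ?_) i
      · exact h2
      · exact congrFun h1 j
    rw [← he.tsum_eq]
    · congr 1
      funext n
      have hle : ((n.1 ⟨0, by simp⟩ : ℕ+) : WithTop ℕ+) ≤ hd (e n).1.1 := by
        unfold hd
        split_ifs with h
        · exact WithTop.coe_le_coe.2 (n.2 (Fin.zero_le _))
        · exact le_top
      have hprod : (∏ i, ENNReal.ofReal ((1 : ℝ) / ((n.1 i : ℕ) : ℝ) ^ ((k :: L).get i)))
        = ENNReal.ofReal ((1 : ℝ) / ((n.1 ⟨0, by simp⟩ : ℕ) : ℝ) ^ k) *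
          ∏ i : Fin L.length, ENNReal.ofReal ((1 : ℝ) / (((e n).1.1 i : ℕ) : ℝ) ^ (L.get i)) :=
        Fin.prod_univ_succ (n := L.length) _
      have hhd : hd n.1 = ((n.1 ⟨0, by simp⟩ : ℕ+) : WithTop ℕ+) := by
        unfold hd
        rw [dif_pos]
      rw [hprod, hhd]
      change _ * (if ((n.1 ⟨0, by simp⟩ : ℕ+) : WithTop ℕ+) ≤ hd (e n).1.1 then _ else _) = _
      rw [if_pos hle]
      change _ * (ENNReal.ofReal ((1 : ℝ) / ((n.1 ⟨0, by simp⟩ : ℕ) : ℝ) ^ k) * _) = _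
      ring
    · intro p hp
      rcases p with ⟨⟨g, hg⟩, m⟩
      have hle : (m : WithTop ℕ+) ≤ hd g := by
        by_contra hcon
        apply hp
        simp [hcon]
      refine ⟨⟨(Fin.cons m g : Fin (L.length + 1) → ℕ+), ?_⟩, ?_⟩
      · intro i j
        refine Fin.cases ?_ (fun i => ?_) i
        · refine Fin.cases ?_ (fun j => ?_) j
          · intro _; exact le_rfl
          · intro _
            have hl : 0 < L.length := j.pos
            unfold hd at hle
            rw [dif_pos hl] at hle
            exact (WithTop.coe_le_coe.1 hle).trans (hg (Fin.mk_le_of_le_val (Nat.zero_le _)))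
        · refine Fin.cases ?_ (fun j => ?_) j
          · intro h
            exact absurd h (not_le.2 (Fin.succ_pos i))
          · intro h
            exact hg (Fin.succ_le_succ_iff.1 h)
      · rfl
/-- region for one chain -/
def chainR (k : ℕ) (u : ℝ) : Set (Fin (k + 1) → ℝ) :=
  {a | (∀ i, a i ∈ Set.Ioo (0 : ℝ) 1) ∧ (∀ i j, i < j → a i < a j) ∧ u < a (Fin.last k)}

theorem measurableSet_chainR (k : ℕ) (u : ℝ) : MeasurableSet (chainR k u) := by
  have : chainR k u = (⋂ i, {a : Fin (k + 1) → ℝ | a i ∈ Set.Ioo (0 : ℝ) 1}) ∩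
    ((⋂ i, ⋂ j, ⋂ (_ : i < j), {a : Fin (k + 1) → ℝ | a i < a j}) ∩
      {a | u < a (Fin.last k)}) := by
    ext a
    simp only [chainR, Set.mem_ofPred_eq, Set.mem_inter_iff, Set.mem_iInter]
  rw [this]
  refine MeasurableSet.inter (MeasurableSet.iInter fun i => ?_)
    (MeasurableSet.inter (MeasurableSet.iInter fun i => MeasurableSet.iInter fun j =>
      MeasurableSet.iInter fun _ => ?_) ?_)
  · exact measurable_pi_apply i measurableSet_Ioo
  · exact measurableSet_lt (measurable_pi_apply i) (measurable_pi_apply j)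
  · exact measurableSet_lt measurable_const (measurable_pi_apply _)

theorem lint_pow (m : ℕ) (hm : 0 < m) (a b : ℝ) (ha : 0 ≤ a) (hab : a ≤ b) :
    ∫⁻ v in Set.Ioo a b, ENNReal.ofReal (v ^ (m - 1)) = ENNReal.ofReal ((b ^ m - a ^ m) / m) := by
  rw [setLIntegral_congr Ioo_ae_eq_Ioc, ← ofReal_integral_eq_lintegral_ofReal]
  · rw [← intervalIntegral.integral_of_le hab, integral_pow]
    congr 1
    have h1 : m - 1 + 1 = m := by omega
    have h2 : ((m - 1 : ℕ) : ℝ) + 1 = m := by exact_mod_cast h1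
    rw [h1, h2]
  · rw [← IntegrableOn, ← intervalIntegrable_iff_integrableOn_Ioc_of_le hab]
    exact (continuous_pow _).intervalIntegrable _ _
  · rw [Filter.EventuallyLE, ae_restrict_iff' measurableSet_Ioc]
    refine Filter.Eventually.of_forall fun x hx => ?_
    exact pow_nonneg (ha.trans hx.1.le) _

theorem chain_int (m : ℕ) (hm : 0 < m) (u : ℝ) (hu : 0 ≤ u) (hu1 : u < 1) (k : ℕ) :
    ∫⁻ a in chainR k u, ENNReal.ofReal (a 0 ^ (m - 1)) *
      ∏ i : Fin k, ENNReal.ofReal (1 / a i.succ) = ENNReal.ofReal ((1 - u ^ m) / m ^ (k + 1)) := by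
  induction k with
  | zero =>
    change ∫⁻ a : Fin 1 → ℝ in chainR 0 u, ENNReal.ofReal (a 0 ^ (m - 1)) *
      ∏ i : Fin 0, ENNReal.ofReal (1 / a i.succ) = _
    have hmp : MeasurePreserving (MeasurableEquiv.funUnique (Fin 1) ℝ).symm
        (volume : Measure ℝ) (volume : Measure (Fin 1 → ℝ)) := by
      convert (volume_preserving_funUnique (Fin 1) ℝ).symm
    rw [← hmp.setLIntegral_comp_preimage_emb (MeasurableEquiv.measurableEmbedding _)
      (fun a : Fin 1 → ℝ => ENNReal.ofReal (a 0 ^ (m - 1)) *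
        ∏ i : Fin 0, ENNReal.ofReal (1 / a i.succ)) (chainR 0 u)]
    have : (MeasurableEquiv.funUnique (Fin 1) ℝ).symm ⁻¹' (chainR 0 u) = Set.Ioo u 1 := by
      ext v
      simp only [chainR, Set.mem_preimage, Set.mem_ofPred_eq, Set.mem_Ioo]
      constructor
      · rintro ⟨h1, -, h3⟩
        exact ⟨h3, (h1 0).2⟩
      · rintro ⟨h1, h2⟩
        refine ⟨fun i => ⟨hu.trans_lt h1, h2⟩, fun i j hij => ?_, h1⟩
        omega
    rw [this]
    simpa using lint_pow m hm u 1 hu hu1.le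
  | succ k ih =>
    have hmp := (volume_preserving_piFinSuccAbove (fun _ : Fin (k + 2) => ℝ) 0).symm
    rw [← hmp.setLIntegral_comp_preimage_emb (MeasurableEquiv.measurableEmbedding _),
      ← lintegral_indicator]
    swap
    · exact (MeasurableEquiv.measurable _) (measurableSet_chainR _ _)
    have hpt : ∀ v : ℝ, ∀ b : Fin (k + 1) → ℝ,
        (MeasurableEquiv.piFinSuccAbove (fun _ : Fin (k + 2) => ℝ) 0).symm (v, b) =
          (Fin.cons v b : Fin (k + 2) → ℝ) := by
      intro v b
      exact Fin.insertNth_zero' v b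
    have hmem : ∀ v : ℝ, ∀ b : Fin (k + 1) → ℝ,
        (Fin.cons v b : Fin (k + 2) → ℝ) ∈ chainR (k + 1) u ↔
          b ∈ chainR k u ∧ v ∈ Set.Ioo 0 (b 0) := by
      intro v b
      constructor
      · rintro ⟨h1, h2, h3⟩
        refine ⟨⟨fun i => h1 i.succ, fun i j hij => h2 i.succ j.succ (Fin.succ_lt_succ_iff.2 hij), h3⟩,
          (h1 0).1, h2 0 (Fin.succ 0) (Fin.succ_pos _)⟩
      · rintro ⟨⟨h1, h2, h3⟩, h4, h5⟩
        refine ⟨?_, ?_, h3⟩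
        · intro i
          refine Fin.cases ?_ (fun i => ?_) i
          · exact ⟨h4, h5.trans (h1 0).2⟩
          · exact h1 i
        · intro i j
          refine Fin.cases ?_ (fun j => ?_) j
          · intro h; exact absurd h (Fin.not_lt_zero _)
          · refine Fin.cases ?_ (fun i => ?_) i
            · intro _
              rcases Fin.eq_zero_or_eq_succ j with rfl | ⟨j', rfl⟩
              · exact h5
              · exact h5.trans (h2 0 j'.succ (Fin.succ_pos _))
            · intro h; exact h2 i j (Fin.succ_lt_succ_iff.1 h)
    rw [Measure.volume_eq_prod, lintegral_prod_symm]
    swap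
    · refine Measurable.aemeasurable (Measurable.indicator ?_ ?_)
      · refine Measurable.comp (g := fun a : Fin (k + 2) → ℝ => ENNReal.ofReal (a 0 ^ (m - 1)) *
          ∏ i : Fin (k + 1), ENNReal.ofReal (1 / a i.succ)) ?_ (MeasurableEquiv.measurable _)
        fun_prop
      · exact (MeasurableEquiv.measurable _) (measurableSet_chainR _ _)
    have hstep : ∀ b : Fin (k + 1) → ℝ,
        (∫⁻ v : ℝ, ((MeasurableEquiv.piFinSuccAbove (fun _ : Fin (k + 2) => ℝ) 0).symm ⁻¹'
          (chainR (k + 1) u)).indicator (fun a => ENNReal.ofReal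
            ((MeasurableEquiv.piFinSuccAbove (fun _ : Fin (k + 2) => ℝ) 0).symm a 0 ^ (m - 1)) *
      ∏ i : Fin (k + 1), ENNReal.ofReal (1 /
        (MeasurableEquiv.piFinSuccAbove (fun _ : Fin (k + 2) => ℝ) 0).symm a i.succ)) (v, b)) =
        (chainR k u).indicator (fun b => ENNReal.ofReal (1 / m) *
          (ENNReal.ofReal (b 0 ^ (m - 1)) * ∏ i : Fin k, ENNReal.ofReal (1 / b i.succ))) b := by
      intro b
      by_cases hb : b ∈ chainR k u
      · rw [Set.indicator_of_mem hb]
        have hb0 := hb.1 0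
        have e1 : ∀ v : ℝ, ((MeasurableEquiv.piFinSuccAbove (fun _ : Fin (k + 2) => ℝ) 0).symm ⁻¹'
          (chainR (k + 1) u)).indicator (fun a => ENNReal.ofReal
            ((MeasurableEquiv.piFinSuccAbove (fun _ : Fin (k + 2) => ℝ) 0).symm a 0 ^ (m - 1)) *
          ∏ i : Fin (k + 1), ENNReal.ofReal (1 /
          (MeasurableEquiv.piFinSuccAbove (fun _ : Fin (k + 2) => ℝ) 0).symm a i.succ)) (v, b) =
          (Set.Ioo 0 (b 0)).indicator (fun v => ENNReal.ofReal (v ^ (m - 1)) *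
            ∏ i : Fin (k + 1), ENNReal.ofReal (1 / b i)) v := by
          intro v
          by_cases hv : v ∈ Set.Ioo 0 (b 0)
          · rw [Set.indicator_of_mem hv, Set.indicator_of_mem]
            · simp only [hpt, Fin.cons_zero, Fin.cons_succ]
            · rw [Set.mem_preimage, hpt]
              exact (hmem v b).2 ⟨hb, hv⟩
          · rw [Set.indicator_of_notMem hv, Set.indicator_of_notMem]
            rw [Set.mem_preimage, hpt]
            exact fun h => hv ((hmem v b).1 h).2
        simp_rw [e1]
        rw [lintegral_indicator measurableSet_Ioo, lintegral_mul_const _ (by fun_prop),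
          lint_pow m hm 0 (b 0) le_rfl hb0.1.le, Fin.prod_univ_succ, ← mul_assoc, ← mul_assoc,
          ← ENNReal.ofReal_mul, ← ENNReal.ofReal_mul]
        · congr 2
          have h1 : m = (m - 1) + 1 := by omega
          have h2 : b 0 ≠ 0 := hb0.1.ne'
          rw [zero_pow hm.ne', sub_zero]
          nth_rewrite 1 [h1]
          rw [pow_succ]
          field_simp
        · positivity
        · have := hb0.1
          rw [zero_pow hm.ne', sub_zero]
          positivity
      · rw [Set.indicator_of_notMem hb]
        have e1 : ∀ v : ℝ, ((MeasurableEquiv.piFinSuccAbove (fun _ : Fin (k + 2) => ℝ) 0).symm ⁻¹'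
          (chainR (k + 1) u)).indicator (fun a => ENNReal.ofReal
            ((MeasurableEquiv.piFinSuccAbove (fun _ : Fin (k + 2) => ℝ) 0).symm a 0 ^ (m - 1)) *
          ∏ i : Fin (k + 1), ENNReal.ofReal (1 /
          (MeasurableEquiv.piFinSuccAbove (fun _ : Fin (k + 2) => ℝ) 0).symm a i.succ)) (v, b) =
          0 := by
          intro v
          rw [Set.indicator_of_notMem]
          rw [Set.mem_preimage, hpt]
          exact fun h => hb ((hmem v b).1 h).1
        simp_rw [e1]
        simp
    simp_rw [hstep]
    rw [lintegral_indicator (measurableSet_chainR _ _), lintegral_const_mul _ (by fun_prop), ih,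
      ← ENNReal.ofReal_mul (by positivity)]
    congr 1
    rw [pow_succ (m : ℝ) (k + 1), div_mul_div_comm, one_mul, mul_comm (m : ℝ)]
/-- carrier of a cons -/
noncomputable def carEquiv (k : ℕ) (L : List ℕ) : Fin k ⊕ Carrier L ≃ Carrier (k :: L) :=
  Equiv.ofBijective (Sum.elim (fun i => (⟨(0 : Fin (L.length + 1)), i⟩ : Carrier (k :: L)))
    (fun p => (⟨Fin.succ p.1, p.2⟩ : Carrier (k :: L)))) (by
    constructor
    · rintro (i | p) (j | q) h
      · have h2 := (Sigma.mk.inj_iff.1 h).2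
        rw [eq_of_heq h2]
      · exact absurd (Sigma.mk.inj_iff.1 h).1 (Fin.succ_ne_zero _).symm
      · exact absurd (Sigma.mk.inj_iff.1 h).1 (Fin.succ_ne_zero _)
      · have h1 := Fin.succ_injective _ (Sigma.mk.inj_iff.1 h).1
        have h2 := (Sigma.mk.inj_iff.1 h).2
        obtain ⟨p1, p2⟩ := p
        obtain ⟨q1, q2⟩ := q
        have h1' : p1 = q1 := h1
        subst h1'
        have h2' : p2 = q2 := eq_of_heq h2
        rw [h2']
    · rintro ⟨j, a⟩
      revert a
      refine Fin.cases (fun a => ?_) (fun j a => ?_) j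
      · exact ⟨Sum.inl a, rfl⟩
      · exact ⟨Sum.inr ⟨j, a⟩, rfl⟩)

theorem carEquiv_inl (k : ℕ) (L : List ℕ) (i : Fin k) :
    carEquiv k L (Sum.inl i) = (⟨(0 : Fin (L.length + 1)), i⟩ : Carrier (k :: L)) := rfl

theorem carEquiv_inr (k : ℕ) (L : List ℕ) (p : Carrier L) :
    carEquiv k L (Sum.inr p) = (⟨Fin.succ p.1, p.2⟩ : Carrier (k :: L)) := rfl

theorem car_le_iff (K : List ℕ) (p q : Carrier K) : p ≤ q ↔ cle K p q := Iff.rfl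

/-- region with extra lower bound on the top of the first chain -/
def regR (L : List ℕ) (u : ℝ) : Set (Carrier L → ℝ) :=
  {t | (∀ p, t p ∈ Set.Ioo (0 : ℝ) 1) ∧ (∀ p q : Carrier L, p < q → t p < t q) ∧
    ∀ p : Carrier L, p.1.val = 0 → p.2.val + 1 = L.get p.1 → u < t p}

theorem inl_lt (k : ℕ) (L : List ℕ) (i j : Fin k) :
    carEquiv k L (Sum.inl i) < carEquiv k L (Sum.inl j) ↔ i < j := by
  rw [lt_iff_le_not_ge, car_le_iff, car_le_iff]
  simp only [carEquiv_inl, cle]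
  rw [Fin.lt_def]
  simp
  exact le_of_lt

theorem inr_lt (k : ℕ) (L : List ℕ) (p q : Carrier L) :
    carEquiv k L (Sum.inr p) < carEquiv k L (Sum.inr q) ↔ p < q := by
  have key : ∀ p q : Carrier L, carEquiv k L (Sum.inr p) ≤ carEquiv k L (Sum.inr q) ↔ p ≤ q := by
    intro p q
    rw [car_le_iff, car_le_iff]
    simp only [carEquiv_inr, cle]
    refine or_congr ?_ ?_
    · refine and_congr ?_ Iff.rfl
      exact Fin.succ_inj
    · refine and_congr Fin.succ_lt_succ_iff (and_congr Iff.rfl (and_congr Iff.rfl ?_))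
      constructor
      · intro h m h1 h2
        exact h m.succ (Fin.succ_lt_succ_iff.2 h1) (Fin.succ_lt_succ_iff.2 h2)
      · intro h m
        refine Fin.cases ?_ (fun m => ?_) m
        · intro h1; exact absurd h1 (Fin.not_lt_zero _)
        · intro h1 h2
          exact h m (Fin.succ_lt_succ_iff.1 h1) (Fin.succ_lt_succ_iff.1 h2)
  rw [lt_iff_le_not_ge, lt_iff_le_not_ge, key, key]

theorem not_inr_lt_inl (k : ℕ) (L : List ℕ) (p : Carrier L) (i : Fin k) :
    ¬ carEquiv k L (Sum.inr p) < carEquiv k L (Sum.inl i) := by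
  intro h
  rcases h.le with h | h
  · exact Fin.succ_ne_zero _ h.1
  · exact Fin.not_lt_zero _ h.1

theorem inl_lt_inr (k : ℕ) (L : List ℕ) (i : Fin k) (q : Carrier L) :
    carEquiv k L (Sum.inl i) < carEquiv k L (Sum.inr q) ↔
      (i.val = 0 ∧ q.2.val + 1 = L.get q.1 ∧ ∀ m : Fin L.length, m < q.1 → L.get m = 1) := by
  constructor
  · intro h
    rcases h.le with h | ⟨h1, h2, h3, h4⟩
    · exact absurd h.1 (Fin.succ_ne_zero _).symm
    · exact ⟨h2, h3, fun m hm => h4 m.succ (Fin.succ_pos _) (Fin.succ_lt_succ_iff.2 hm)⟩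
  · rintro ⟨h1, h2, h3⟩
    refine lt_of_le_of_ne (Or.inr ⟨Fin.succ_pos _, h1, h2, ?_⟩) ?_
    · intro m
      refine Fin.cases ?_ (fun m => ?_) m
      · intro h1; exact absurd h1 (lt_irrefl _)
      · intro _ h
        exact h3 m (Fin.succ_lt_succ_iff.1 h)
    · intro h
      exact absurd ((carEquiv k L).injective h) (by simp)

theorem reg_cons (k : ℕ) (L : List ℕ) (u : ℝ) (t : Carrier ((k + 1) :: L) → ℝ) :
    t ∈ regR ((k + 1) :: L) u ↔
      (fun i => t (carEquiv (k + 1) L (Sum.inl i))) ∈ chainR k u ∧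
      (fun p => t (carEquiv (k + 1) L (Sum.inr p))) ∈
        regR L (t (carEquiv (k + 1) L (Sum.inl 0))) := by
  constructor
  · rintro ⟨h1, h2, h3⟩
    refine ⟨⟨fun i => h1 _, fun i j hij => h2 _ _ ((inl_lt _ _ _ _).2 hij), h3 _ rfl rfl⟩,
      fun p => h1 _, fun p q hpq => h2 _ _ ((inr_lt _ _ _ _).2 hpq), fun p hp hp' => ?_⟩
    refine h2 _ _ ((inl_lt_inr _ _ _ _).2 ⟨rfl, hp', fun m hm => ?_⟩)
    rw [Fin.lt_def, hp] at hm
    omega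
  · rintro ⟨⟨h1, h2, h3⟩, h4, h5, h6⟩
    refine ⟨?_, ?_, ?_⟩
    · intro p
      obtain ⟨p, rfl⟩ := (carEquiv (k + 1) L).surjective p
      rcases p with i | p
      · exact h1 i
      · exact h4 p
    · intro p q hpq
      obtain ⟨p, rfl⟩ := (carEquiv (k + 1) L).surjective p
      obtain ⟨q, rfl⟩ := (carEquiv (k + 1) L).surjective q
      rcases p with i | p
      · rcases q with j | q
        · exact h2 i j ((inl_lt _ _ _ _).1 hpq)
        · obtain ⟨g1, g2, g3⟩ := (inl_lt_inr _ _ _ _).1 hpq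
          have hi : i = 0 := Fin.ext g1
          subst hi
          by_cases hq : q.1.val = 0
          · exact h6 q hq g2
          · have hpos : 0 < L.length := q.1.pos
            have hlt : (⟨0, hpos⟩ : Fin L.length) < q.1 := by
              rw [Fin.lt_def]; simp only; omega
            have hone := g3 ⟨0, hpos⟩ hlt
            let z : Carrier L := ⟨⟨0, hpos⟩, ⟨0, by rw [hone]; exact one_pos⟩⟩
            have hz : t (carEquiv (k + 1) L (Sum.inl 0)) < t (carEquiv (k + 1) L (Sum.inr z)) :=
              h6 z rfl hone.symm
            refine hz.trans (h5 z q (lt_of_le_of_ne (Or.inr ⟨hlt, rfl, g2, fun m _ hm => g3 m hm⟩) ?_))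
            intro hzq
            apply hq
            rw [← hzq]
      · rcases q with j | q
        · exact absurd hpq (not_inr_lt_inl _ _ _ _)
        · exact h5 p q ((inr_lt _ _ _ _).1 hpq)
    · intro p
      obtain ⟨p, rfl⟩ := (carEquiv (k + 1) L).surjective p
      rcases p with i | p
      · intro _ h
        have h' : i.val + 1 = k + 1 := h
        have hi : i = Fin.last k := Fin.ext (by simpa using h')
        rw [hi]
        exact h3
      · intro h
        exact absurd h (by simp [carEquiv_inr])

theorem measurableSet_regR (L : List ℕ) (u : ℝ) : MeasurableSet (regR L u) := by
  have : regR L u = (⋂ i, {a : Carrier L → ℝ | a i ∈ Set.Ioo (0 : ℝ) 1}) ∩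
    ((⋂ i, ⋂ j, ⋂ (_ : i < j), {a : Carrier L → ℝ | a i < a j}) ∩
      ⋂ p : Carrier L, ⋂ (_ : p.1.val = 0), ⋂ (_ : p.2.val + 1 = L.get p.1), {a | u < a p}) := by
    ext a
    simp only [regR, Set.mem_ofPred_eq, Set.mem_inter_iff, Set.mem_iInter]
  rw [this]
  refine MeasurableSet.inter (MeasurableSet.iInter fun i => ?_)
    (MeasurableSet.inter (MeasurableSet.iInter fun i => MeasurableSet.iInter fun j =>
      MeasurableSet.iInter fun _ => ?_) (MeasurableSet.iInter fun i => MeasurableSet.iInter fun _ =>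
      MeasurableSet.iInter fun _ => ?_))
  · exact measurable_pi_apply i measurableSet_Ioo
  · exact measurableSet_lt (measurable_pi_apply i) (measurable_pi_apply j)
  · exact measurableSet_lt measurable_const (measurable_pi_apply _)
/-- `1 - u ^ N` -/
noncomputable def phi (u : ℝ) : WithTop ℕ+ → ℝ≥0∞ :=
  WithTop.recTopCoe 1 (fun n : ℕ+ => ENNReal.ofReal (1 - u ^ (n : ℕ)))

theorem phi_top (u : ℝ) : phi u ⊤ = 1 := rfl

theorem phi_coe (u : ℝ) (n : ℕ+) :
    phi u (n : WithTop ℕ+) = ENNReal.ofReal (1 - u ^ (n : ℕ)) := rfl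

/-- the two weights -/
noncomputable def om (d : Fin 2) (s : ℝ) : ℝ≥0∞ :=
  if d = 0 then ENNReal.ofReal (1 / s) else ENNReal.ofReal (1 / (1 - s))

theorem measurable_om (d : Fin 2) : Measurable (om d) := by
  unfold om
  split_ifs <;> fun_prop

open Classical in
theorem geom_key (v : ℝ) (hv : v ∈ Set.Ioo (0 : ℝ) 1) (N : WithTop ℕ+) :
    ENNReal.ofReal (1 / (1 - v)) * phi v N =
      ∑' m : ℕ+, if (m : WithTop ℕ+) ≤ N then ENNReal.ofReal (v ^ ((m : ℕ) - 1)) else 0 := by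
  have hv1 : 0 < 1 - v := by linarith [hv.2]
  rw [← Equiv.pnatEquivNat.symm.tsum_eq]
  induction N using WithTop.recTopCoe with
  | top =>
    have e : ∀ c : ℕ, (if ((Equiv.pnatEquivNat.symm c : ℕ+) : WithTop ℕ+) ≤ ⊤ then
        ENNReal.ofReal (v ^ (((Equiv.pnatEquivNat.symm c : ℕ+) : ℕ) - 1)) else 0) =
        ENNReal.ofReal (v ^ c) := by
      intro c
      rw [if_pos le_top]
      simp
    simp_rw [e]
    rw [← ENNReal.ofReal_tsum_of_nonneg (fun n => pow_nonneg hv.1.le n)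
      (summable_geometric_of_lt_one hv.1.le hv.2), tsum_geometric_of_lt_one hv.1.le hv.2]
    simp [phi_top]
  | coe n =>
    have e : ∀ c : ℕ, (if ((Equiv.pnatEquivNat.symm c : ℕ+) : WithTop ℕ+) ≤ (n : WithTop ℕ+) then
        ENNReal.ofReal (v ^ (((Equiv.pnatEquivNat.symm c : ℕ+) : ℕ) - 1)) else 0) =
        if c < (n : ℕ) then ENNReal.ofReal (v ^ c) else 0 := by
      intro c
      have : ((Equiv.pnatEquivNat.symm c : ℕ+) : WithTop ℕ+) ≤ (n : WithTop ℕ+) ↔ c < (n : ℕ) := by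
        rw [WithTop.coe_le_coe, ← PNat.coe_le_coe]
        simp
      simp only [this]
      simp
    simp_rw [e]
    rw [tsum_eq_sum (s := Finset.range n)]
    · rw [Finset.sum_congr rfl (fun c hc => if_pos (Finset.mem_range.1 hc)),
        ← ENNReal.ofReal_sum_of_nonneg (fun i _ => pow_nonneg hv.1.le i)]
      simp only [phi_coe]
      rw [← ENNReal.ofReal_mul (by positivity), ← geom_sum_mul_neg v n]
      congr 1
      field_simp
    · intro c hc
      rw [if_neg]
      simpa using hc

/-- splitting off the first chain -/
noncomputable def splitE (k : ℕ) (L : List ℕ) :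
    ((Fin k → ℝ) × (Carrier L → ℝ)) ≃ᵐ (Carrier (k :: L) → ℝ) :=
  (MeasurableEquiv.sumPiEquivProdPi (fun _ : Fin k ⊕ Carrier L => ℝ)).symm.trans
    (MeasurableEquiv.piCongrLeft (fun _ : Carrier (k :: L) => ℝ) (carEquiv k L))

theorem splitE_mp (k : ℕ) (L : List ℕ) : MeasurePreserving (splitE k L) volume volume :=
  (volume_measurePreserving_sumPiEquivProdPi_symm (fun _ : Fin k ⊕ Carrier L => ℝ)).trans
    (volume_measurePreserving_piCongrLeft (fun _ : Carrier (k :: L) => ℝ) (carEquiv k L))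

theorem splitE_inl (k : ℕ) (L : List ℕ) (a : Fin k → ℝ) (b : Carrier L → ℝ) (i : Fin k) :
    splitE k L (a, b) (carEquiv k L (Sum.inl i)) = a i :=
  Equiv.piCongrLeft_apply_apply (fun _ : Carrier (k :: L) => ℝ) (carEquiv k L) _ _

theorem splitE_inr (k : ℕ) (L : List ℕ) (a : Fin k → ℝ) (b : Carrier L → ℝ) (p : Carrier L) :
    splitE k L (a, b) (carEquiv k L (Sum.inr p)) = b p :=
  Equiv.piCongrLeft_apply_apply (fun _ : Carrier (k :: L) => ℝ) (carEquiv k L) _ _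

theorem prod_split (k : ℕ) (L : List ℕ) (a : Fin (k + 1) → ℝ) (b : Carrier L → ℝ) :
    ∏ p, om (lab ((k + 1) :: L) p) (splitE (k + 1) L (a, b) p) =
      (ENNReal.ofReal (1 / (1 - a 0)) * ∏ i : Fin k, ENNReal.ofReal (1 / a i.succ)) *
        ∏ p, om (lab L p) (b p) := by
  rw [← (carEquiv (k + 1) L).prod_comp, Fintype.prod_sum_type, Fin.prod_univ_succ]
  simp only [splitE_inl, splitE_inr]
  congr 1

theorem G_cons (k : ℕ) (L : List ℕ) (u : ℝ) :
    ∫⁻ t in regR ((k + 1) :: L) u, ∏ p, om (lab ((k + 1) :: L) p) (t p) =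
      ∫⁻ a in chainR k u,
        (ENNReal.ofReal (1 / (1 - a 0)) * ∏ i : Fin k, ENNReal.ofReal (1 / a i.succ)) *
        ∫⁻ b in regR L (a 0), ∏ p, om (lab L p) (b p) := by
  have hmeas : ∀ L : List ℕ, Measurable (fun t : Carrier L → ℝ => ∏ p, om (lab L p) (t p)) := by
    intro L
    exact Finset.measurable_prod _ (fun p _ => (measurable_om _).comp (measurable_pi_apply p))
  have hset : MeasurableSet (splitE (k + 1) L ⁻¹' regR ((k + 1) :: L) u) :=
    (splitE (k + 1) L).measurable (measurableSet_regR _ _)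
  rw [← (splitE_mp (k + 1) L).setLIntegral_comp_preimage_emb (MeasurableEquiv.measurableEmbedding _),
    ← lintegral_indicator hset, Measure.volume_eq_prod, lintegral_prod,
    ← lintegral_indicator (measurableSet_chainR _ _)]
  swap
  · exact (((hmeas _).comp (splitE (k + 1) L).measurable).indicator hset).aemeasurable
  congr 1
  funext a
  have hmem : ∀ b, (a, b) ∈ splitE (k + 1) L ⁻¹' regR ((k + 1) :: L) u ↔
      a ∈ chainR k u ∧ b ∈ regR L (a 0) := by
    intro b
    rw [Set.mem_preimage, reg_cons]
    simp only [splitE_inl, splitE_inr]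
  by_cases ha : a ∈ chainR k u
  · rw [Set.indicator_of_mem ha, ← lintegral_indicator (measurableSet_regR _ _),
      ← lintegral_const_mul _ ((hmeas L).indicator (measurableSet_regR _ _))]
    congr 1
    funext b
    by_cases hb : b ∈ regR L (a 0)
    · rw [Set.indicator_of_mem hb, Set.indicator_of_mem ((hmem b).2 ⟨ha, hb⟩), prod_split]
    · rw [Set.indicator_of_notMem hb, Set.indicator_of_notMem (fun h => hb ((hmem b).1 h).2),
        mul_zero]
  · rw [Set.indicator_of_notMem ha]
    have : ∀ b, (splitE (k + 1) L ⁻¹' regR ((k + 1) :: L) u).indicator (fun x =>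
        ∏ p, om (lab ((k + 1) :: L) p) (splitE (k + 1) L x p)) (a, b) = 0 := fun b =>
      Set.indicator_of_notMem (fun h => ha ((hmem b).1 h).1) _
    simp_rw [this]
    simp

theorem G_eq (L : List ℕ) : (∀ n ∈ L, 0 < n) → ∀ u : ℝ, 0 ≤ u → u < 1 →
    ∫⁻ t in regR L u, ∏ p, om (lab L p) (t p) = WW L (phi u) := by
  induction L with
  | nil =>
    intro _ u _ _
    have hE : IsEmpty (Carrier []) := ⟨fun p => p.1.elim0⟩
    have hreg : regR [] u = Set.univ := by
      ext t
      simp only [Set.mem_univ, iff_true]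
      exact ⟨fun p => hE.elim p, fun p => hE.elim p, fun p => hE.elim p⟩
    rw [hreg, Measure.restrict_univ, volume_pi]
    simp [WW]
    rfl
  | cons k L ih =>
    intro hpos u hu hu1
    classical
    obtain ⟨k, rfl⟩ : ∃ j, k = j + 1 := ⟨k - 1, by have := hpos k (by simp); omega⟩
    have ih' := ih (fun n hn => hpos n (by simp [hn]))
    rw [G_cons]
    have h1 : ∀ a ∈ chainR k u,
        (ENNReal.ofReal (1 / (1 - a 0)) * ∏ i : Fin k, ENNReal.ofReal (1 / a i.succ)) *
          ∫⁻ b in regR L (a 0), ∏ p, om (lab L p) (b p) =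
        WW L (fun N => ∑' m : ℕ+, if (m : WithTop ℕ+) ≤ N then
          ENNReal.ofReal (a 0 ^ ((m : ℕ) - 1)) * ∏ i : Fin k, ENNReal.ofReal (1 / a i.succ)
            else 0) := by
      intro a ha
      rw [ih' _ (ha.1 0).1.le (ha.1 0).2, ← WW_mul]
      congr 1
      funext N
      rw [mul_right_comm, geom_key _ (ha.1 0), ← ENNReal.tsum_mul_right]
      congr 1
      funext m
      rw [ite_mul, zero_mul]
    rw [setLIntegral_congr_fun (measurableSet_chainR _ _) h1]
    have hm : ∀ N : WithTop ℕ+, ∀ m : ℕ+, Measurable (fun a : Fin (k + 1) → ℝ =>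
        if (m : WithTop ℕ+) ≤ N then
          ENNReal.ofReal (a 0 ^ ((m : ℕ) - 1)) * ∏ i : Fin k, ENNReal.ofReal (1 / a i.succ)
            else 0) := by
      intro N m
      split_ifs <;> fun_prop
    rw [← (WW_lintegral _ L _ (fun N => Measurable.tsum (hm N))).2]
    simp only [WW]
    congr 1
    funext N
    rw [lintegral_tsum (fun m => (hm N m).aemeasurable)]
    congr 1
    funext m
    split_ifs
    · rw [chain_int m m.pos u hu hu1 k]
      change _ = _ * ENNReal.ofReal (1 - u ^ (m : ℕ))
      rw [← ENNReal.ofReal_mul (by positivity)]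
      congr 1
      ring
    · simp

theorem phi_zero (N : WithTop ℕ+) : phi 0 N = 1 := by
  induction N using WithTop.recTopCoe with
  | top => rfl
  | coe n => simp [phi_coe]

theorem main_eq (K : List ℕ) (hpos : ∀ n ∈ K, 0 < n) :
    zetaStar K = Ifun (Carrier K) (lab K) := by
  have hG := G_eq K hpos 0 le_rfl zero_lt_one
  rw [WW_eq] at hG
  simp only [phi_zero, mul_one] at hG
  have hreg : {t : Carrier K → ℝ | (∀ p, t p ∈ Set.Ioo (0 : ℝ) 1) ∧
      ∀ p q : Carrier K, p < q → t p < t q} = regR K 0 := by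
    ext t
    exact ⟨fun h => ⟨h.1, h.2, fun p _ _ => (h.1 p).1⟩, fun h => ⟨h.1, h.2.1⟩⟩
  have hnn : ∀ t ∈ regR K 0, ∀ p, (0 : ℝ) ≤ (if lab K p = 0 then 1 / t p else 1 / (1 - t p)) := by
    intro t ht p
    have := ht.1 p
    have h1 : 0 ≤ 1 - t p := by linarith [this.2]
    have h2 := this.1.le
    split_ifs <;> positivity
  unfold zetaStar Ifun
  rw [hreg, integral_eq_lintegral_of_nonneg_ae]
  · have h1 : ∫⁻ t in regR K 0, ENNReal.ofReal
        (∏ p, (if lab K p = 0 then 1 / t p else 1 / (1 - t p))) =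
        ∫⁻ t in regR K 0, ∏ p, om (lab K p) (t p) := by
      refine setLIntegral_congr_fun (measurableSet_regR _ _) (fun t ht => ?_)
      rw [ENNReal.ofReal_prod_of_nonneg (fun p _ => hnn t ht p)]
      refine Finset.prod_congr rfl fun p _ => ?_
      unfold om
      split_ifs <;> rfl
    rw [h1, hG, ENNReal.tsum_toReal_eq]
    · congr 1
      funext n
      rw [ENNReal.toReal_prod]
      refine Finset.prod_congr rfl fun i _ => ?_
      rw [ENNReal.toReal_ofReal (by positivity)]
    · intro n
      exact ENNReal.prod_ne_top fun i _ => ENNReal.ofReal_ne_top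
  · rw [Filter.EventuallyLE, ae_restrict_iff' (measurableSet_regR _ _)]
    exact Filter.Eventually.of_forall fun t ht => Finset.prod_nonneg fun p _ => hnn t ht p
  · refine Measurable.aestronglyMeasurable (Finset.measurable_prod _ fun p _ => ?_)
    split_ifs <;> fun_prop
theorem zetaStar_eq_Ifun (K : List ℕ) (hne : K ≠ []) (hpos : ∀ n ∈ K, 0 < n)
    (hlast : 2 ≤ K.getLast hne) :
    ((∀ p : Carrier K, IsMax p → lab K p = 0) ∧
        (∀ p : Carrier K, IsMin p → lab K p = 1)) ∧
      zetaStar K = Ifun (Carrier K) (lab K) := by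
  refine ⟨⟨?_, ?_⟩, main_eq K hpos⟩
  · rintro ⟨j, a⟩ hp
    by_contra hcon
    have ha : a.val = 0 := by
      by_contra h
      exact hcon (if_neg h)
    by_cases hk : 2 ≤ K.get j
    · have hle : @LE.le (Carrier K) _ ⟨j, a⟩ ⟨j, ⟨1, hk⟩⟩ :=
        Or.inl ⟨rfl, by simp [ha]⟩
      rcases hp hle with h | h
      · have h2 : 1 ≤ a.val := h.2
        omega
      · exact lt_irrefl _ h.1
    · have hj : j.val + 1 < K.length := by
        by_contra hj
        apply hk
        have hjj : j.val = K.length - 1 := by have := j.isLt; omega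
        rw [List.getLast_eq_getElem] at hlast
        rw [List.get_eq_getElem]
        simpa only [hjj] using hlast
      have hpos' : 0 < K.get ⟨j.val + 1, hj⟩ := hpos _ (List.get_mem _ _)
      have hlt : j < ⟨j.val + 1, hj⟩ := by rw [Fin.lt_def]; simp
      have hle : @LE.le (Carrier K) _ ⟨j, a⟩
          ⟨⟨j.val + 1, hj⟩, ⟨K.get ⟨j.val + 1, hj⟩ - 1, by omega⟩⟩ := by
        refine Or.inr ⟨hlt, ha, ?_, ?_⟩
        · simp only; omega
        · intro m h1 h2
          rw [Fin.lt_def] at h1 h2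
          simp only at h1 h2
          omega
      rcases hp hle with h | h
      · exact absurd h.1 hlt.ne'
      · exact absurd h.1 hlt.asymm
  · rintro ⟨j, a⟩ hp
    have hle : @LE.le (Carrier K) _ ⟨j, ⟨0, a.pos⟩⟩ ⟨j, a⟩ :=
      Or.inl ⟨rfl, Nat.zero_le _⟩
    refine if_pos ?_
    rcases hp hle with h | h
    · exact Nat.le_zero.1 h.2
    · exact absurd h.1 (lt_irrefl _)
end
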